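/- Evaluation of the B = O limit: with Q and B commuting with all other parameters, A, Z invertible, ‖Q‖ < 1, ‖Z‖ < 1, the type I bilateral series f(A,B,Z) at B = O satisfies f(A, O, Z) = [∏_{j=0}^∞ (I − Q^{j+1})] · ⌈Z^{−1}A^{−1}Q; Z^{−1}A^{−1}ZQ; Q, I⌋_∞ · f(A, Q, Z), where ⌈Z^{−1}A^{−1}Q; Z^{−1}A^{−1}ZQ; Q, I⌋_∞ is the infinite type I Q-shifted factorial and f(A,Q,Z) = ⌊AZ; Z; Q, I⌉_∞ = ∏_{j=0}^∞ (I − ZQ^j)^{−1}(I − AZQ^j) by the noncommutative q-binomial theorem. -/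

import Mathlib

open Filter

/-- Integer powers of `Q`, with negative powers given by powers of `Ring.inverse Q`. -/
noncomputable def zpowR {R : Type*} [Ring R] (Q : R) (m : ℤ) : R :=
  if 0 ≤ m then Q ^ m.toNat else (Ring.inverse Q) ^ (-m).toNat

/-- The bilateral ordered product `∏_{j=1}^k X j`: for `k ≥ 0` it is
`X 1 * X 2 * ⋯ * X k` (left to right), and for `k < 0` it is
`(X 0)⁻¹ * (X (-1))⁻¹ * ⋯ * (X (k+1))⁻¹`, following the inverse-reversed convention. -/
noncomputable def bprod {R : Type*} [Ring R] (X : ℤ → R) (k : ℤ) : R :=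
  if 0 ≤ k then ((List.range k.toNat).map (fun i => X ((i : ℤ) + 1))).prod
  else ((List.range (-k).toNat).map (fun i => Ring.inverse (X (-(i : ℤ))))).prod

/-- The `k`-th term `⌈A; B; Q, Z⌋_k` of the noncommutative bilateral basic hypergeometric
series of type I: `∏_{j=1}^k (I - B Q^{k-j})⁻¹ (I - A Q^{k-j}) Z`. -/
noncomputable def termI {R : Type*} [Ring R] (Q A B Z : R) (k : ℤ) : R :=
  bprod (fun j => Ring.inverse (1 - B * zpowR Q (k - j)) * (1 - A * zpowR Q (k - j)) * Z) k

/-- The `k`-th term `⌊A; B; Q, Z⌉_k` of the noncommutative bilateral basic hypergeometric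
series of type II: `∏_{j=1}^k (I - B Q^{j-1})⁻¹ (I - A Q^{j-1}) Z`. -/
noncomputable def termII {R : Type*} [Ring R] (Q A B Z : R) (k : ℤ) : R :=
  bprod (fun j => Ring.inverse (1 - B * zpowR Q (j - 1)) * (1 - A * zpowR Q (j - 1)) * Z) k

section Multiplier

variable {R : Type*} [Ring R]

theorem zpowR_units (q : Rˣ) (m : ℤ) : zpowR (q : R) m = ((q ^ m : Rˣ) : R) := by
  unfold zpowR
  split_ifs with h
  · lift m to ℕ using h
    simp
  · obtain ⟨n, rfl⟩ : ∃ n : ℕ, m = -n := ⟨(-m).toNat, by omega⟩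
    simp

theorem commute_ringInverse {a b : R} (ha : IsUnit a) (h : Commute a b) :
    Commute (Ring.inverse a) b := by
  obtain ⟨u, rfl⟩ := ha
  rw [Ring.inverse_unit]
  exact h.units_inv_left

/-- The ratio of consecutive terms of the type I series. -/
noncomputable def ratioI (Q A B Z : R) (m : ℤ) : R :=
  Ring.inverse (1 - B * zpowR Q m) * (1 - A * zpowR Q m) * Z

theorem termI_zero (Q A B Z : R) : termI Q A B Z 0 = 1 := by
  simp [termI, bprod]

theorem bprod_natCast (X : ℤ → R) (n : ℕ) :
    bprod X n = ((List.range n).map fun i : ℕ => X (i + 1)).prod := by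
  simp [bprod, ← List.map_eq_flatMap, Function.comp_def]

theorem bprod_neg_natCast (X : ℤ → R) (n : ℕ) :
    bprod X (-n) = ((List.range n).map fun i : ℕ => Ring.inverse (X (-i))).prod := by
  rcases Nat.eq_zero_or_pos n with rfl | hn
  · simp [bprod]
  · have h : ¬ (0 : ℤ) ≤ -(n : ℤ) := by omega
    simp only [bprod, h, if_false, neg_neg, Int.toNat_natCast]
    simp [← List.map_eq_flatMap, Function.comp_def]

theorem termI_natCast_succ (Q A B Z : R) (n : ℕ) :
    termI Q A B Z (n + 1) = ratioI Q A B Z n * termI Q A B Z n := by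
  rw [← Nat.cast_succ]
  simp only [termI, bprod_natCast, List.range_succ_eq_map, List.map_cons, List.prod_cons,
    List.map_map, ratioI]
  congr 1
  · simp
  · congr 1
    apply List.map_congr_left
    intro i _
    simp only [Function.comp, Nat.cast_succ]
    rw [show (n : ℤ) + 1 - ((i : ℤ) + 1 + 1) = n - (i + 1) by ring]

theorem termI_neg_succ (Q A B Z : R) (n : ℕ) :
    termI Q A B Z (-n - 1) =
      Ring.inverse (ratioI Q A B Z (-n - 1)) * termI Q A B Z (-n) := by
  rw [show -(n : ℤ) - 1 = -((n + 1 : ℕ) : ℤ) by push_cast; ring]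
  simp only [termI, bprod_neg_natCast, List.range_succ_eq_map, List.map_cons, List.prod_cons,
    List.map_map, ratioI]
  congr 2
  apply List.map_congr_left
  intro i _
  simp only [Function.comp, Nat.cast_succ]
  rw [show -((n : ℤ) + 1) - -((i : ℤ) + 1) = -n - -i by ring]

theorem termI_B_zero_succ {Q A Z : R} (hA : ∀ m : ℤ, IsUnit (1 - A * zpowR Q m))
    (hZ : IsUnit Z) (k : ℤ) :
    termI Q A 0 Z (k + 1) = (1 - A * zpowR Q k) * Z * termI Q A 0 Z k := by
  have hr (m : ℤ) : ratioI Q A 0 Z m = (1 - A * zpowR Q m) * Z := by simp [ratioI]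
  rcases le_or_gt 0 k with hk | hk
  · lift k to ℕ using hk
    rw [termI_natCast_succ, hr]
  · obtain ⟨n, rfl⟩ : ∃ n : ℕ, k = -n - 1 := ⟨(-k - 1).toNat, by omega⟩
    rw [termI_neg_succ, hr, Ring.mul_inverse_cancel_left _ _ ((hA _).mul hZ)]
    congr 1
    ring

/-- The inverse `q`-factorial `∏_{j=1}^n (1 - Q^j)⁻¹`. -/
noncomputable def invQFactorial (Q : R) : ℕ → R
  | 0 => 1
  | n + 1 => Ring.inverse (1 - Q ^ (n + 1)) * invQFactorial Q n

/-- The inverse `q`-factorial, extended by zero to negative integers. -/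
noncomputable def invQFactorialInt (Q : R) (m : ℤ) : R :=
  if 0 ≤ m then invQFactorial Q m.toNat else 0

theorem invQFactorialInt_natCast (Q : R) (n : ℕ) :
    invQFactorialInt Q n = invQFactorial Q n := by
  simp [invQFactorialInt]

theorem invQFactorialInt_of_neg (Q : R) {m : ℤ} (h : m < 0) : invQFactorialInt Q m = 0 :=
  if_neg (not_le.2 h)

theorem invQFactorial_commute {Q X : R} (hu : ∀ j : ℕ, IsUnit (1 - Q ^ (j + 1)))
    (h : Commute Q X) (n : ℕ) : Commute (invQFactorial Q n) X := by
  induction n with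
  | zero => exact Commute.one_left X
  | succ n ih =>
    exact (commute_ringInverse (hu n) ((Commute.one_left X).sub_left (h.pow_left _))).mul_left ih

theorem invQFactorialInt_commute {Q X : R} (hu : ∀ j : ℕ, IsUnit (1 - Q ^ (j + 1)))
    (h : Commute Q X) (m : ℤ) : Commute (invQFactorialInt Q m) X := by
  unfold invQFactorialInt
  split_ifs
  · exact invQFactorial_commute hu h _
  · exact Commute.zero_left X

theorem invQFactorial_eq {Q : R} (hu : ∀ j : ℕ, IsUnit (1 - Q ^ (j + 1))) (n : ℕ) :
    invQFactorial Q n = (1 - Q ^ (n + 1)) * invQFactorial Q (n + 1) := by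
  rw [invQFactorial, Ring.mul_inverse_cancel_left _ _ (hu n)]

theorem invQFactorialInt_eq {q : Rˣ} (hu : ∀ j : ℕ, IsUnit (1 - (q : R) ^ (j + 1))) (m : ℤ) :
    invQFactorialInt (q : R) m =
      (1 - ((q ^ (m + 1) : Rˣ) : R)) * invQFactorialInt (q : R) (m + 1) := by
  rcases le_or_gt 0 m with hm | hm
  · lift m to ℕ using hm
    have h := invQFactorialInt_natCast (q : R) (m + 1)
    push_cast at h
    rw [invQFactorialInt_natCast, h, invQFactorial_eq hu]
    norm_cast
  · rw [invQFactorialInt_of_neg _ hm]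
    rcases eq_or_ne m (-1) with rfl | h
    · simp
    · rw [invQFactorialInt_of_neg _ (by omega), mul_zero]

theorem prod_mul_invQFactorial {Q : R} (hu : ∀ j : ℕ, IsUnit (1 - Q ^ (j + 1))) (n : ℕ) :
    ((List.range n).map fun j => 1 - Q ^ (j + 1)).prod * invQFactorial Q n = 1 := by
  induction n with
  | zero => simp [invQFactorial]
  | succ n ih =>
    rw [List.range_succ, List.map_append, List.prod_append, mul_assoc]
    simpa [← invQFactorial_eq hu] using ih

theorem termI_B_self {q : Rˣ} {A Z : R} (hqA : Commute (q : R) A) (hqZ : Commute (q : R) Z)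
    (hu : ∀ j : ℕ, IsUnit (1 - (q : R) ^ (j + 1))) (k : ℤ) :
    termI (q : R) A q Z k = invQFactorialInt (q : R) k * termI (q : R) A 0 Z k := by
  rcases le_or_gt 0 k with hk | hk
  · lift k to ℕ using hk
    rw [invQFactorialInt_natCast]
    induction k with
    | zero => simp [termI_zero, invQFactorial]
    | succ n ih =>
      push_cast
      rw [termI_natCast_succ, termI_natCast_succ, ih]
      have h0 : ratioI (q : R) A 0 Z n = (1 - A * (q : R) ^ n) * Z := by
        simp [ratioI, zpowR_units]
      have h1 : ratioI (q : R) A q Z n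
          = Ring.inverse (1 - (q : R) ^ (n + 1)) * ratioI (q : R) A 0 Z n := by
        simp [ratioI, zpowR_units, pow_succ', mul_assoc]
      have hc : Commute (invQFactorial (q : R) n) (ratioI (q : R) A 0 Z n) := by
        rw [h0]
        apply invQFactorial_commute hu
        exact ((Commute.one_right _).sub_right
          (hqA.mul_right ((Commute.refl _).pow_right n))).mul_right hqZ
      rw [h1, invQFactorial, mul_assoc, ← mul_assoc (ratioI _ _ _ _ _), ← hc.eq]
      simp only [mul_assoc]
  · obtain ⟨n, rfl⟩ : ∃ n : ℕ, k = -n - 1 := ⟨(-k - 1).toNat, by omega⟩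
    rw [invQFactorialInt_of_neg _ hk, zero_mul]
    clear hk
    induction n with
    | zero =>
      rw [termI_neg_succ]
      simp [ratioI, zpowR_units]
    | succ n ih =>
      rw [termI_neg_succ]
      push_cast
      rw [show -((n : ℤ) + 1) = -n - 1 by ring, ih, mul_zero]

end Multiplier

section Analysis

variable {R : Type*} [NormedRing R]

theorem summable_norm_of_ratio [CompleteSpace R] {q a z : Rˣ} (hqA : Commute (q : R) a)
    (hq : ‖(q : R)‖ < 1) (hz : ‖(z : R)‖ < 1) {T : ℤ → R}
    (hT : ∀ k : ℤ, T (k + 1) = (1 - (a : R) * ((q ^ k : Rˣ) : R)) * z * T k) :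
    Summable fun k => ‖T k‖ := by
  have hpow : Tendsto (fun n : ℕ => ‖(q : R) ^ n‖) atTop (nhds 0) := by
    simpa using (tendsto_pow_atTop_nhds_zero_of_norm_lt_one hq).norm
  apply Summable.of_nat_of_neg
  · apply summable_of_ratio_norm_eventually_le (r := (1 + ‖(z : R)‖) / 2) (by linarith)
    have hlim : Tendsto (fun n : ℕ => ‖(z : R)‖ + ‖(a : R)‖ * ‖(q : R) ^ n‖ * ‖(z : R)‖) atTop
        (nhds (‖(z : R)‖ + ‖(a : R)‖ * 0 * ‖(z : R)‖)) :=
      ((hpow.const_mul _).mul_const _).const_add _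
    have hev := hlim.eventually_lt_const (u := (1 + ‖(z : R)‖) / 2) (by linarith)
    filter_upwards [hev] with n hn
    rw [norm_norm, norm_norm]
    push_cast
    rw [hT n]
    calc ‖(1 - (a : R) * ((q ^ (n : ℤ) : Rˣ) : R)) * z * T n‖
        ≤ ‖(1 - (a : R) * ((q ^ (n : ℤ) : Rˣ) : R)) * z‖ * ‖T n‖ := norm_mul_le _ _
      _ ≤ _ := by
        gcongr
        refine le_trans ?_ hn.le
        rw [sub_mul, one_mul]
        refine (norm_sub_le _ _).trans ?_
        gcongr
        refine (norm_mul_le _ _).trans ?_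
        gcongr
        refine (norm_mul_le _ _).trans ?_
        simp
  · apply summable_of_ratio_norm_eventually_le (r := 1 / 2) (by norm_num)
    set K := ‖((z⁻¹ : Rˣ) : R) * ((a⁻¹ : Rˣ) : R)‖ with hK
    have hlim : Tendsto (fun n : ℕ => K * ‖(q : R) ^ (n + 1)‖) atTop (nhds (K * 0)) :=
      ((tendsto_add_atTop_iff_nat (f := fun n => ‖(q : R) ^ n‖) 1).2 hpow).const_mul _
    have hev := hlim.eventually_lt_const (u := 1 / 4) (by norm_num)
    filter_upwards [hev] with n hn
    rw [norm_norm, norm_norm]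
    push_cast
    have h := hT (-n - 1)
    rw [show -(n : ℤ) - 1 + 1 = -n by ring] at h
    rw [show -((n : ℤ) + 1) = -n - 1 by ring]
    set x := T (-n)
    set y := T (-n - 1)
    have hinv : (q : R) ^ (n + 1) * ((q ^ (-(n : ℤ) - 1) : Rˣ) : R) = 1 := by
      rw [← Units.val_pow_eq_pow_val, ← Units.val_mul, ← zpow_natCast, ← zpow_add]
      simp
    have hc : (q : R) ^ (n + 1) * (a : R) = a * (q : R) ^ (n + 1) :=
      (hqA.pow_left _).eq
    have hx : (q : R) ^ (n + 1) * (z * y - x) = a * (z * y) := by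
      calc (q : R) ^ (n + 1) * (z * y - x)
          = (q : R) ^ (n + 1) * a * ((q ^ (-(n : ℤ) - 1) : Rˣ) : R) * z * y := by
            rw [h]; noncomm_ring
        _ = a * ((q : R) ^ (n + 1) * ((q ^ (-(n : ℤ) - 1) : Rˣ) : R)) * z * y := by
            rw [hc]; noncomm_ring
        _ = a * (z * y) := by rw [hinv]; noncomm_ring
    have hy : y = ((z⁻¹ : Rˣ) : R) * ((a⁻¹ : Rˣ) : R) * ((q : R) ^ (n + 1) * (z * y - x)) := by
      rw [hx, mul_assoc, Units.inv_mul_cancel_left, Units.inv_mul_cancel_left]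
    have h1 : ‖y‖ ≤ 1 / 4 * (‖y‖ + ‖x‖) := by
      calc ‖y‖ ≤ K * ‖(q : R) ^ (n + 1) * (z * y - x)‖ := by
            conv_lhs => rw [hy]
            exact norm_mul_le _ _
        _ ≤ K * (‖(q : R) ^ (n + 1)‖ * ‖z * y - x‖) := by
            gcongr
            exact norm_mul_le _ _
        _ = K * ‖(q : R) ^ (n + 1)‖ * ‖z * y - x‖ := by ring
        _ ≤ 1 / 4 * (‖y‖ + ‖x‖) := by
            gcongr
            refine (norm_sub_le _ _).trans ?_
            gcongr
            refine (norm_mul_le _ _).trans ?_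
            nlinarith [norm_nonneg y]
    linarith [norm_nonneg y]

theorem norm_pow_le_max {Q : R} (hQ : ‖Q‖ < 1) (n : ℕ) : ‖Q ^ n‖ ≤ max ‖(1 : R)‖ 1 := by
  rcases Nat.eq_zero_or_pos n with rfl | hn
  · simp
  · exact ((norm_pow_le' Q hn).trans (pow_le_one₀ (norm_nonneg _) hQ.le)).trans (le_max_right _ _)

theorem exists_norm_invQFactorial_le {Q : R} (hu : ∀ j : ℕ, IsUnit (1 - Q ^ (j + 1)))
    (hQ : ‖Q‖ < 1) : ∃ C : ℝ, ∀ n, ‖invQFactorial Q n‖ ≤ C := by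
  set r := ‖Q‖ with hr
  have hr0 : 0 ≤ r := norm_nonneg _
  have hr1 : 0 < 1 - r := by linarith
  have hstep (n : ℕ) : ‖invQFactorial Q (n + 1)‖
      ≤ ‖invQFactorial Q n‖ * Real.exp ((1 - r)⁻¹ * r ^ n) := by
    set x := invQFactorial Q (n + 1) with hx
    have h1 : ‖x‖ ≤ ‖invQFactorial Q n‖ + r ^ (n + 1) * ‖x‖ := by
      have h : x = invQFactorial Q n + Q ^ (n + 1) * x := by
        rw [invQFactorial_eq hu]; noncomm_ring
      calc ‖x‖ = ‖invQFactorial Q n + Q ^ (n + 1) * x‖ := by rw [← h]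
        _ ≤ ‖invQFactorial Q n‖ + ‖Q ^ (n + 1)‖ * ‖x‖ :=
          (norm_add_le _ _).trans (by gcongr; exact norm_mul_le _ _)
        _ ≤ _ := by
          gcongr
          exact norm_pow_le' Q n.succ_pos
    have hle : r ^ (n + 1) ≤ r := by
      simpa using pow_le_pow_of_le_one hr0 hQ.le (Nat.le_add_left 1 n)
    have hle' : r ^ (n + 1) ≤ r ^ n := pow_le_pow_of_le_one hr0 hQ.le n.le_succ
    have h2 : 1 ≤ (1 - r ^ (n + 1)) * (1 + (1 - r)⁻¹ * r ^ n) := by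
      have h3 : (1 - r) * (1 - r)⁻¹ = 1 := mul_inv_cancel₀ hr1.ne'
      have h4 : 0 ≤ (1 - r)⁻¹ * r ^ n := by positivity
      nlinarith
    calc ‖x‖ = ‖x‖ * 1 := (mul_one _).symm
      _ ≤ ‖x‖ * ((1 - r ^ (n + 1)) * (1 + (1 - r)⁻¹ * r ^ n)) := by gcongr
      _ = (‖x‖ - r ^ (n + 1) * ‖x‖) * (1 + (1 - r)⁻¹ * r ^ n) := by ring
      _ ≤ ‖invQFactorial Q n‖ * Real.exp ((1 - r)⁻¹ * r ^ n) := by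
        gcongr
        · linarith
        · linarith [Real.add_one_le_exp ((1 - r)⁻¹ * r ^ n)]
  have hind (n : ℕ) : ‖invQFactorial Q n‖
      ≤ ‖(1 : R)‖ * Real.exp ((1 - r)⁻¹ * ∑ i ∈ Finset.range n, r ^ i) := by
    induction n with
    | zero => simp [invQFactorial]
    | succ n ih =>
      rw [Finset.sum_range_succ, mul_add, Real.exp_add, ← mul_assoc]
      exact (hstep n).trans (by gcongr)
  refine ⟨‖(1 : R)‖ * Real.exp ((1 - r)⁻¹ * (1 - r)⁻¹), fun n => (hind n).trans ?_⟩
  gcongr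
  rw [← tsum_geometric_of_lt_one hr0 hQ]
  exact (summable_geometric_of_lt_one hr0 hQ).sum_le_tsum _ fun i _ => by positivity

theorem exists_norm_invQFactorialInt_le {Q : R} (hu : ∀ j : ℕ, IsUnit (1 - Q ^ (j + 1)))
    (hQ : ‖Q‖ < 1) : ∃ C : ℝ, ∀ m, ‖invQFactorialInt Q m‖ ≤ C := by
  obtain ⟨C, hC⟩ := exists_norm_invQFactorial_le hu hQ
  refine ⟨C, fun m => ?_⟩
  unfold invQFactorialInt
  split_ifs
  · exact hC _
  · simpa using (norm_nonneg _).trans (hC 0)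

theorem exists_tendsto_invQFactorialInt [CompleteSpace R] {Q : R}
    (hu : ∀ j : ℕ, IsUnit (1 - Q ^ (j + 1))) (hQ : ‖Q‖ < 1) :
    ∃ E : R, Tendsto (invQFactorial Q) atTop (nhds E) ∧
      Tendsto (invQFactorialInt Q) atTop (nhds E) := by
  obtain ⟨C, hC⟩ := exists_norm_invQFactorial_le hu hQ
  have hcauchy : CauchySeq (invQFactorial Q) := by
    refine cauchySeq_of_le_geometric ‖Q‖ C hQ fun n => ?_
    have h : invQFactorial Q n - invQFactorial Q (n + 1)
        = -(Q ^ (n + 1) * invQFactorial Q (n + 1)) := by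
      rw [invQFactorial_eq hu]; noncomm_ring
    rw [dist_eq_norm, h, norm_neg]
    refine (norm_mul_le _ _).trans ?_
    rw [mul_comm C]
    gcongr
    · exact (norm_pow_le' Q n.succ_pos).trans
        (pow_le_pow_of_le_one (norm_nonneg _) hQ.le n.le_succ)
    · exact hC _
  obtain ⟨E, hE⟩ := cauchySeq_tendsto_of_complete hcauchy
  have htoNat : Tendsto Int.toNat atTop atTop := by
    refine tendsto_atTop.2 fun b => ?_
    filter_upwards [eventually_ge_atTop (b : ℤ)] with m hm
    omega
  refine ⟨E, hE, (hE.comp htoNat).congr' ?_⟩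
  filter_upwards [eventually_ge_atTop (0 : ℤ)] with m hm
  simp [invQFactorialInt, hm]

theorem summable_mul_of_norm_le [CompleteSpace R] {ι : Type*} {c T : ι → R} {C : ℝ}
    (hT : Summable fun k => ‖T k‖) (hc : ∀ k, ‖c k‖ ≤ C) : Summable fun k => c k * T k :=
  (hT.mul_left C).of_norm_bounded fun k =>
    (norm_mul_le _ _).trans (mul_le_mul_of_nonneg_right (hc k) (norm_nonneg _))

theorem norm_invQFactorialInt_mul_zpow_le {q : Rˣ} {C : ℝ} (hq : ‖(q : R)‖ < 1)
    (hC : ∀ m, ‖invQFactorialInt (q : R) m‖ ≤ C) (n : ℕ) (k : ℤ) :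
    ‖invQFactorialInt (q : R) k * ((q ^ k : Rˣ) : R) ^ n‖ ≤ C * max ‖(1 : R)‖ 1 := by
  have hC0 : 0 ≤ C := (norm_nonneg _).trans (hC 0)
  rcases le_or_gt 0 k with hk | hk
  · lift k to ℕ using hk
    refine (norm_mul_le _ _).trans (mul_le_mul (hC _) ?_ (norm_nonneg _) hC0)
    rw [zpow_natCast, Units.val_pow_eq_pow_val, ← pow_mul]
    exact norm_pow_le_max hq _
  · rw [invQFactorialInt_of_neg _ hk, zero_mul, norm_zero]
    positivity

section Series

variable [CompleteSpace R] {q a z : Rˣ} {T : ℤ → R}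

theorem tsum_shift_step (hqA : Commute (q : R) a) (hqZ : Commute (q : R) z)
    (hu : ∀ j : ℕ, IsUnit (1 - (q : R) ^ (j + 1))) (hq : ‖(q : R)‖ < 1)
    (hT : ∀ k : ℤ, T (k + 1) = (1 - (a : R) * ((q ^ k : Rˣ) : R)) * z * T k)
    (hsum : Summable fun k => ‖T k‖) (n : ℕ) :
    (1 - ((z⁻¹ : Rˣ) : R) * ((a⁻¹ : Rˣ) : R) * z * (q : R) ^ (n + 1)) *
        (∑' k : ℤ, invQFactorialInt (q : R) ((n + 1 : ℕ) + k) * T k) =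
      (1 - ((z⁻¹ : Rˣ) : R) * ((a⁻¹ : Rˣ) : R) * (q : R) ^ (n + 1)) *
        ∑' k : ℤ, invQFactorialInt (q : R) (n + k) * T k := by
  obtain ⟨C, hC⟩ := exists_norm_invQFactorialInt_le hu hq
  set e := invQFactorialInt (q : R) with he
  set w : R := (q : R) ^ (n + 1) with hw
  set s : ℤ → R := fun k => e ((n + 1 : ℕ) + k) * T k with hs
  set t : ℤ → R := fun k => e (n + k) * T k with ht
  have hss : Summable s := summable_mul_of_norm_le hsum fun k => hC _
  have hts : Summable t := summable_mul_of_norm_le hsum fun k => hC _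
  have hwA : Commute w (a : R) := hqA.pow_left _
  have hwZ : Commute w (z : R) := hqZ.pow_left _
  have hterm (k : ℤ) : w * t (k + 1) = w * z * s k - a * z * (s k - t k) := by
    set x : R := ((q ^ k : Rˣ) : R) with hx
    have hxZ : Commute x (z : R) := hqZ.units_zpow_left k
    have heA : Commute (e ((n + 1 : ℕ) + k)) (a : R) := invQFactorialInt_commute hu hqA _
    have heZ : Commute (e ((n + 1 : ℕ) + k)) (z : R) := invQFactorialInt_commute hu hqZ _
    have heq : Commute (e ((n + 1 : ℕ) + k)) x :=
      (invQFactorialInt_commute hu (Commute.refl _) _).units_zpow_right k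
    have h1 : e (n + (k + 1)) = e ((n + 1 : ℕ) + k) := by congr 1; push_cast; ring
    have h2 : s k - t k = w * x * s k := by
      have h : e (n + k) = (1 - w * x) * e ((n + 1 : ℕ) + k) := by
        rw [he, invQFactorialInt_eq hu, hw, hx, ← Units.val_pow_eq_pow_val, ← Units.val_mul,
          ← zpow_natCast, ← zpow_add, show (n : ℤ) + k + 1 = (n + 1 : ℕ) + k by push_cast; ring]
      simp only [hs, ht, h]
      noncomm_ring
    have h3 : t (k + 1) = (1 - a * x) * z * s k := by
      simp only [ht, hs]
      rw [h1, hT k, ← mul_assoc,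
        (((Commute.one_right _).sub_right (heA.mul_right heq)).mul_right heZ).eq, mul_assoc]
    have h4 : a * z * (w * x * s k) = w * (a * x * z * s k) := by
      calc a * z * (w * x * s k) = a * (z * w) * x * s k := by noncomm_ring
        _ = (a * w) * (z * x) * s k := by rw [← hwZ.eq]; noncomm_ring
        _ = w * (a * x * z * s k) := by rw [← hwA.eq, ← hxZ.eq]; noncomm_ring
    rw [h2, h3, h4]
    noncomm_ring
  have hsum_eq : w * ∑' k, t k = w * z * ∑' k, s k - a * z * (∑' k, s k - ∑' k, t k) := by
    rw [← hss.tsum_sub hts, ← (hss.sub hts).tsum_mul_left, ← hss.tsum_mul_left,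
      ← (hss.mul_left _).tsum_sub ((hss.sub hts).mul_left _), ← hts.tsum_mul_left,
      ← (Equiv.addRight (1 : ℤ)).tsum_eq]
    exact tsum_congr hterm
  have hwz : Commute w ((z⁻¹ : Rˣ) : R) := hwZ.units_inv_right
  have hwa : Commute w ((a⁻¹ : Rˣ) : R) := hwA.units_inv_right
  set S := ∑' k, s k
  set G := ∑' k, t k
  have hl : a * z * S - w * z * S = a * z * G - w * G := by
    rw [hsum_eq]; noncomm_ring
  have hl' := congrArg (fun y => ((z⁻¹ : Rˣ) : R) * (((a⁻¹ : Rˣ) : R) * y)) hl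
  simp only [mul_sub, mul_assoc, Units.inv_mul_cancel_left] at hl'
  rw [sub_mul, sub_mul, one_mul, one_mul]
  simp only [mul_assoc]
  rw [← mul_assoc _ w S, ← hwZ.eq, mul_assoc]
  exact hl'

theorem tsum_shift_eq (hqA : Commute (q : R) a) (hqZ : Commute (q : R) z)
    (hu : ∀ j : ℕ, IsUnit (1 - (q : R) ^ (j + 1))) (hq : ‖(q : R)‖ < 1)
    (hu3 : ∀ j : ℕ, IsUnit (1 - ((z⁻¹ : Rˣ) : R) * ((a⁻¹ : Rˣ) : R) * z * (q : R) ^ (j + 1)))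
    (hT : ∀ k : ℤ, T (k + 1) = (1 - (a : R) * ((q ^ k : Rˣ) : R)) * z * T k)
    (hsum : Summable fun k => ‖T k‖) (n : ℕ) :
    (∑' k : ℤ, invQFactorialInt (q : R) (n + k) * T k) =
      ((List.range n).map fun i =>
        Ring.inverse (1 - ((z⁻¹ : Rˣ) : R) * ((a⁻¹ : Rˣ) : R) * z * (q : R) ^ (n - i))
        * (1 - ((z⁻¹ : Rˣ) : R) * ((a⁻¹ : Rˣ) : R) * (q : R) ^ (n - i))).prod *
      ∑' k : ℤ, invQFactorialInt (q : R) k * T k := by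
  induction n with
  | zero => simp
  | succ n ih =>
    rw [List.range_succ_eq_map, List.map_cons, List.prod_cons, List.map_map]
    simp only [Function.comp_def, Nat.succ_eq_add_one, Nat.add_sub_add_right, Nat.sub_zero]
    rw [mul_assoc, ← ih, mul_assoc, ← tsum_shift_step hqA hqZ hu hq hT hsum n,
      Ring.inverse_mul_cancel_left _ _ (hu3 n)]

theorem tsum_eq_mul_tsum_invQFactorialInt (hqA : Commute (q : R) a) (hqZ : Commute (q : R) z)
    (hu : ∀ j : ℕ, IsUnit (1 - (q : R) ^ (j + 1))) (hq : ‖(q : R)‖ < 1)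
    (hu3 : ∀ j : ℕ, IsUnit (1 - ((z⁻¹ : Rˣ) : R) * ((a⁻¹ : Rˣ) : R) * z * (q : R) ^ (j + 1)))
    (hT : ∀ k : ℤ, T (k + 1) = (1 - (a : R) * ((q ^ k : Rˣ) : R)) * z * T k)
    (hsum : Summable fun k => ‖T k‖) {P₀ P₁ : R}
    (hP₀ : Tendsto (fun n : ℕ => ((List.range n).map fun j =>
      1 - (q : R) ^ (j + 1)).prod) atTop (nhds P₀))
    (hP₁ : Tendsto (fun n : ℕ => ((List.range n).map fun i =>
      Ring.inverse (1 - ((z⁻¹ : Rˣ) : R) * ((a⁻¹ : Rˣ) : R) * z * (q : R) ^ (n - i))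
      * (1 - ((z⁻¹ : Rˣ) : R) * ((a⁻¹ : Rˣ) : R) * (q : R) ^ (n - i))).prod) atTop (nhds P₁)) :
    ∑' k, T k = P₀ * P₁ * ∑' k : ℤ, invQFactorialInt (q : R) k * T k := by
  obtain ⟨C, hC⟩ := exists_norm_invQFactorialInt_le hu hq
  obtain ⟨E, hE, hE'⟩ := exists_tendsto_invQFactorialInt hu hq
  have hPE : P₀ * E = 1 := by
    refine tendsto_nhds_unique (hP₀.mul hE) ?_
    simp only [prod_mul_invQFactorial hu]
    exact tendsto_const_nhds
  have hlim : Tendsto (fun n : ℕ => ∑' k : ℤ, invQFactorialInt (q : R) (n + k) * T k) atTop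
      (nhds (∑' k, E * T k)) := by
    refine tendsto_tsum_of_dominated_convergence (hsum.mul_left C) (fun k => ?_)
      (Eventually.of_forall fun n k => ?_)
    · refine Tendsto.mul_const _ (hE'.comp ?_)
      exact tendsto_atTop_add_const_right _ _ tendsto_natCast_atTop_atTop
    · exact (norm_mul_le _ _).trans (mul_le_mul_of_nonneg_right (hC _) (norm_nonneg _))
  have h : ∑' k, E * T k = P₁ * ∑' k : ℤ, invQFactorialInt (q : R) k * T k := by
    refine tendsto_nhds_unique hlim ?_
    simp only [tsum_shift_eq hqA hqZ hu hq hu3 hT hsum]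
    exact hP₁.mul_const _
  rw [mul_assoc, ← h, hsum.of_norm.tsum_mul_left, ← mul_assoc, hPE, one_mul]

theorem tsum_binomial_step (hqA : Commute (q : R) a) (hqZ : Commute (q : R) z)
    (hu : ∀ j : ℕ, IsUnit (1 - (q : R) ^ (j + 1))) (hq : ‖(q : R)‖ < 1)
    (hT : ∀ k : ℤ, T (k + 1) = (1 - (a : R) * ((q ^ k : Rˣ) : R)) * z * T k)
    (hsum : Summable fun k => ‖T k‖) (n : ℕ) :
    (1 - (z : R) * (q : R) ^ n) *
        (∑' k : ℤ, invQFactorialInt (q : R) k * ((q ^ k : Rˣ) : R) ^ n * T k) =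
      (1 - (a : R) * z * (q : R) ^ n) *
        ∑' k : ℤ, invQFactorialInt (q : R) k * ((q ^ k : Rˣ) : R) ^ (n + 1) * T k := by
  obtain ⟨C, hC⟩ := exists_norm_invQFactorialInt_le hu hq
  set e := invQFactorialInt (q : R) with he
  set v : R := (q : R) ^ n with hv
  set s : ℤ → R := fun k => e k * ((q ^ k : Rˣ) : R) ^ n * T k with hs
  set t : ℤ → R := fun k => e k * ((q ^ k : Rˣ) : R) ^ (n + 1) * T k with ht
  have hss : Summable s :=
    summable_mul_of_norm_le hsum fun k => norm_invQFactorialInt_mul_zpow_le hq hC n k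
  have hts : Summable t :=
    summable_mul_of_norm_le hsum fun k => norm_invQFactorialInt_mul_zpow_le hq hC (n + 1) k
  have hterm (k : ℤ) : s (k + 1) - t (k + 1) = z * v * s k - a * z * v * t k := by
    set x : R := ((q ^ k : Rˣ) : R) with hx
    have hxA : Commute x (a : R) := hqA.units_zpow_left k
    have hxZ : Commute x (z : R) := hqZ.units_zpow_left k
    have hxq : Commute x (q : R) := (Commute.refl (q : R)).units_zpow_left k
    have heA : Commute (e k) (a : R) := invQFactorialInt_commute hu hqA _
    have heZ : Commute (e k) (z : R) := invQFactorialInt_commute hu hqZ _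
    have heq : Commute (e k) (q : R) := invQFactorialInt_commute hu (Commute.refl _) _
    have hex : Commute (e k) x := heq.units_zpow_right k
    set y : R := ((q ^ (k + 1) : Rˣ) : R) with hy
    have hyx : y = q * x := by rw [hy, zpow_add_one, Units.val_mul, hxq.eq]
    have hyn : y ^ n = v * x ^ n := by rw [hyx, hxq.symm.mul_pow]
    have hye : Commute y (e (k + 1)) :=
      ((invQFactorialInt_commute hu (Commute.refl (q : R)) _).units_zpow_right (k + 1)).symm
    have h1 : s (k + 1) - t (k + 1) = e k * (v * x ^ n) * T (k + 1) := by
      rw [← hyn, he, invQFactorialInt_eq hu k, ← he]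
      simp only [hs, ht, pow_succ']
      rw [← mul_assoc (e (k + 1)) y, ← hye.eq]
      noncomm_ring
    have hc : Commute (e k * (v * x ^ n)) ((z : R) - a * z * x) := by
      have hcz : Commute (e k * (v * x ^ n)) (z : R) :=
        heZ.mul_left ((hqZ.pow_left n).mul_left (hxZ.pow_left n))
      have hca : Commute (e k * (v * x ^ n)) (a : R) :=
        heA.mul_left ((hqA.pow_left n).mul_left (hxA.pow_left n))
      have hcx : Commute (e k * (v * x ^ n)) x :=
        hex.mul_left ((hxq.symm.pow_left n).mul_left ((Commute.refl x).pow_left n))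
      exact hcz.sub_right ((hca.mul_right hcz).mul_right hcx)
    have h2 : (1 - a * x) * z = (z : R) - a * z * x := by
      rw [sub_mul, one_mul, mul_assoc, hxZ.eq, mul_assoc]
    have hve : e k * (v * x ^ n) = v * (e k * x ^ n) := by
      rw [← mul_assoc, (heq.pow_right n).eq, mul_assoc]
    have hxe : x * (e k * x ^ n) = e k * x ^ (n + 1) := by
      rw [← mul_assoc, ← hex.eq, mul_assoc, pow_succ']
    have hxv : x * v = v * x := (hxq.pow_right n).eq
    rw [h1, hT k, h2, ← mul_assoc, hc.eq, hve]
    simp only [hs, ht]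
    rw [← hxe]
    simp only [sub_mul, mul_assoc]
    rw [← mul_assoc x v, hxv, mul_assoc]
  have hsum_eq : ∑' k, s k - ∑' k, t k = z * v * ∑' k, s k - a * z * v * ∑' k, t k := by
    rw [← hss.tsum_mul_left, ← hts.tsum_mul_left,
      ← (hss.mul_left _).tsum_sub (hts.mul_left _), ← hss.tsum_sub hts,
      ← (Equiv.addRight (1 : ℤ)).tsum_eq]
    exact tsum_congr hterm
  rw [sub_mul, sub_mul, one_mul, one_mul]
  exact sub_eq_sub_iff_sub_eq_sub.1 hsum_eq

/-- The noncommutative `q`-binomial theorem. -/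
theorem tsum_invQFactorialInt_mul_eq (hqA : Commute (q : R) a) (hqZ : Commute (q : R) z)
    (hu : ∀ j : ℕ, IsUnit (1 - (q : R) ^ (j + 1))) (hq : ‖(q : R)‖ < 1)
    (hu2 : ∀ j : ℕ, IsUnit (1 - (z : R) * (q : R) ^ j))
    (hT : ∀ k : ℤ, T (k + 1) = (1 - (a : R) * ((q ^ k : Rˣ) : R)) * z * T k)
    (hT0 : T 0 = 1) (hsum : Summable fun k => ‖T k‖) {P₂ : R}
    (hP₂ : Tendsto (fun n : ℕ => ((List.range n).map fun j =>
      Ring.inverse (1 - (z : R) * (q : R) ^ j) * (1 - a * z * (q : R) ^ j)).prod)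
      atTop (nhds P₂)) :
    ∑' k : ℤ, invQFactorialInt (q : R) k * T k = P₂ := by
  obtain ⟨C, hC⟩ := exists_norm_invQFactorialInt_le hu hq
  have hiter (n : ℕ) : ∑' k : ℤ, invQFactorialInt (q : R) k * T k =
      ((List.range n).map fun j =>
        Ring.inverse (1 - (z : R) * (q : R) ^ j) * (1 - a * z * (q : R) ^ j)).prod *
      ∑' k : ℤ, invQFactorialInt (q : R) k * ((q ^ k : Rˣ) : R) ^ n * T k := by
    induction n with
    | zero => simp
    | succ n ih =>
      rw [ih, List.range_succ, List.map_append, List.prod_append, mul_assoc]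
      simp only [List.map_cons, List.map_nil, List.prod_singleton]
      rw [mul_assoc, ← tsum_binomial_step hqA hqZ hu hq hT hsum n,
        Ring.inverse_mul_cancel_left _ _ (hu2 n)]
  have hlim : Tendsto (fun n : ℕ =>
      ∑' k : ℤ, invQFactorialInt (q : R) k * ((q ^ k : Rˣ) : R) ^ n * T k) atTop
      (nhds (∑' k : ℤ, if k = 0 then (1 : R) else 0)) := by
    refine tendsto_tsum_of_dominated_convergence (hsum.mul_left (C * max ‖(1 : R)‖ 1))
      (fun k => ?_) (Eventually.of_forall fun n k => ?_)
    · rcases lt_trichotomy k 0 with hk | rfl | hk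
      · simp [invQFactorialInt_of_neg _ hk, hk.ne]
      · simp [hT0, invQFactorialInt, invQFactorial]
      · lift k to ℕ using hk.le
        have hk0 : 0 < k := by exact_mod_cast hk
        have hpow : Tendsto (fun n : ℕ => ((q : R) ^ k) ^ n) atTop (nhds 0) :=
          tendsto_pow_atTop_nhds_zero_of_norm_lt_one
            ((norm_pow_le' _ hk0).trans_lt (pow_lt_one₀ (norm_nonneg _) hq hk0.ne'))
        simpa [hk0.ne'] using (hpow.const_mul (invQFactorialInt (q : R) k)).mul_const (T k)
    · exact (norm_mul_le _ _).trans (mul_le_mul_of_nonneg_right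
        (norm_invQFactorialInt_mul_zpow_le hq hC n k) (norm_nonneg _))
  rw [tsum_ite_eq] at hlim
  refine tendsto_nhds_unique ?_ (by simpa using hP₂.mul hlim)
  simp only [← hiter]
  exact tendsto_const_nhds

end Series

end Analysis

/-- evaluation of the `B = O` limit:
`f(A,O,Z) = [∏_{j=0}^∞ (I-Q^{j+1})] · ⌈Z⁻¹A⁻¹Q; Z⁻¹A⁻¹ZQ; Q, I⌋_∞ · f(A,Q,Z)`, and
`f(A,Q,Z) = ⌊AZ; Z; Q, I⌉_∞ = ∏_{j=0}^∞ (I-ZQ^j)⁻¹(I-AZQ^j)` by the noncommutative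
q-binomial theorem; the infinite products are limits of partial products. -/
theorem bilateral_typeI_B_zero {R : Type*} [NormedRing R] [NormedAlgebra ℂ R]
    [CompleteSpace R] (Q A Z : R)
    (hQA : Q * A = A * Q) (hQZ : Q * Z = Z * Q)
    (hAu : IsUnit A) (hZu : IsUnit Z) (hQu : IsUnit Q)
    (huA : ∀ m : ℤ, IsUnit (1 - A * zpowR Q m))
    (hu1 : ∀ j : ℕ, IsUnit (1 - Q ^ (j + 1)))
    (hu2 : ∀ j : ℕ, IsUnit (1 - Z * Q ^ j))
    (hu3 : ∀ j : ℕ, IsUnit (1 - Ring.inverse Z * Ring.inverse A * Z * Q ^ (j + 1)))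
    (hQ : ‖Q‖ < 1) (hZ : ‖Z‖ < 1)
    (hs0 : Summable (fun k : ℤ => termI Q A 0 Z k))
    (hsQ : Summable (fun k : ℤ => termI Q A Q Z k))
    (P₀ P₁ P₂ : R)
    -- P₀ = ∏_{j=0}^∞ (I - Q^{j+1})
    (hP₀ : Tendsto (fun n : ℕ => ((List.range n).map (fun j =>
        (1 - Q ^ (j + 1)))).prod) atTop (nhds P₀))
    -- P₁ = ⌈Z⁻¹A⁻¹Q; Z⁻¹A⁻¹ZQ; Q, I⌋_∞, limit of the falling-order partial products
    (hP₁ : Tendsto (fun k : ℕ => ((List.range k).map (fun i =>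
        Ring.inverse (1 - Ring.inverse Z * Ring.inverse A * Z * Q ^ (k - i))
        * (1 - Ring.inverse Z * Ring.inverse A * Q ^ (k - i)))).prod) atTop (nhds P₁))
    -- P₂ = ⌊AZ; Z; Q, I⌉_∞
    (hP₂ : Tendsto (fun n : ℕ => ((List.range n).map (fun j =>
        Ring.inverse (1 - Z * Q ^ j) * (1 - A * Z * Q ^ j))).prod) atTop (nhds P₂)) :
    (∑' k : ℤ, termI Q A 0 Z k) = P₀ * P₁ * (∑' k : ℤ, termI Q A Q Z k)
      ∧ (∑' k : ℤ, termI Q A Q Z k) = P₂ := by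
  obtain ⟨q, rfl⟩ := hQu
  obtain ⟨a, rfl⟩ := hAu
  obtain ⟨z, rfl⟩ := hZu
  simp only [Ring.inverse_unit] at hu3
  have hP₁' := hP₁
  rw [Ring.inverse_unit, Ring.inverse_unit] at hP₁'
  have hT (k : ℤ) : termI (q : R) a 0 z (k + 1)
      = (1 - (a : R) * ((q ^ k : Rˣ) : R)) * z * termI (q : R) a 0 z k := by
    rw [termI_B_zero_succ huA z.isUnit, zpowR_units]
  have hsum := summable_norm_of_ratio hQA hQ hZ hT
  simp only [termI_B_self hQA hQZ hu1]
  exact ⟨tsum_eq_mul_tsum_invQFactorialInt hQA hQZ hu1 hQ hu3 hT hsum hP₀ hP₁',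
    tsum_invQFactorialInt_mul_eq hQA hQZ hu1 hQ hu2 hT (termI_zero _ _ _ _) hsum hP₂⟩
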